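/- Let R be a commutative Noetherian ring, M a finitely generated R-module, and N a proper submodule of M. Suppose N = M_0 ⊂ M_1 ⊂ ⋯ ⊂ M_n = M is a regular prime extension filtration of M over N with prime ideals p_1, …, p_n, and let p_1', …, p_n' be a reordering of p_1, …, p_n such that p_i' ⊄ p_j' whenever i < j. Then there exists a regular prime extension filtration N = M_0' ⊂ M_1' ⊂ ⋯ ⊂ M_n' = M of M over N in which M_i' is a regular p_i'-prime extension of M_{i-1}' for each i. -/

import Mathlib

open Submodule

section Defs

variable {R : Type*} [CommRing R] {M : Type*} [AddCommGroup M] [Module R M]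

/-- `K` is a `p`-prime extension of `N` (i.e. `N` is a `p`-prime submodule of `K`):
`(N : K) = p` and for all `a : R`, `x ∈ K`, `a • x ∈ N` implies `a ∈ p` or `x ∈ N`. -/
def IsPrimeExtension (p : Ideal R) (N K : Submodule R M) : Prop :=
  p.IsPrime ∧ N ≤ K ∧ N.colon K = p ∧
    ∀ (a : R) (x : M), x ∈ K → a • x ∈ N → a ∈ p ∨ x ∈ N

/-- `K` is a maximal `p`-prime extension of `N` in the ambient module: no `p`-prime
extension of `N` properly contains `K`. -/
def IsMaximalPrimeExtension (p : Ideal R) (N K : Submodule R M) : Prop :=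
  IsPrimeExtension p N K ∧ ∀ L : Submodule R M, IsPrimeExtension p N L → ¬ K < L

/-- `K` is a regular `p`-prime extension of `N` in the ambient module: `K` is a maximal
`p`-prime extension of `N` and `p` is a maximal element of `Ass(M/N)`. -/
def IsRegularPrimeExtension (p : Ideal R) (N K : Submodule R M) : Prop :=
  IsMaximalPrimeExtension p N K ∧ p ∈ associatedPrimes R (M ⧸ N) ∧
    ∀ q ∈ associatedPrimes R (M ⧸ N), p ≤ q → q = p

/-- `F 0 = N ⊂ F 1 ⊂ ⋯ ⊂ F n = M` is a regular prime extension (RPE) filtration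
of the ambient module over `N`, with prime ideals `p 0, …, p (n-1)`. -/
def IsRPEFiltration (N : Submodule R M) (n : ℕ) (F : Fin (n + 1) → Submodule R M)
    (p : Fin n → Ideal R) : Prop :=
  F 0 = N ∧ F (Fin.last n) = ⊤ ∧
    ∀ i : Fin n, IsRegularPrimeExtension (p i) (F i.castSucc) (F i.succ)

/-- `N` has generalized prime ideal factorization given by the multiset `S` of primes. -/
def HasPFactorization (N : Submodule R M) (S : Multiset (Ideal R)) : Prop :=
  ∃ (n : ℕ) (F : Fin (n + 1) → Submodule R M) (p : Fin n → Ideal R),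
    IsRPEFiltration N n F p ∧ (List.ofFn p : Multiset (Ideal R)) = S

end Defs

section Helpers

variable {R : Type*} [CommRing R] {M : Type*} [AddCommGroup M] [Module R M]

theorem mem_associatedPrimes_quotient_iff [IsNoetherianRing R] {N : Submodule R M} {p : Ideal R} :
    p ∈ associatedPrimes R (M ⧸ N) ↔ p.IsPrime ∧ ∃ x : M, ∀ a : R, a ∈ p ↔ a • x ∈ N := by
  rw [AssociatedPrimes.mem_iff, isAssociatedPrime_iff, and_congr_right_iff]
  intro _
  rw [N.mkQ_surjective.exists]
  refine exists_congr fun x => ?_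
  rw [SetLike.ext_iff]
  refine forall_congr' fun a => ?_
  rw [mem_colon_singleton, mem_bot, ← map_smul, mkQ_apply, Quotient.mk_eq_zero]

/-- The submodule `(N :_M I)` of elements of `M` which `I` multiplies into `N`. -/
def colonIdeal (N : Submodule R M) (I : Ideal R) : Submodule R M where
  carrier := {x | ∀ a ∈ I, a • x ∈ N}
  add_mem' hx hy a ha := by
    rw [smul_add]
    exact N.add_mem (hx a ha) (hy a ha)
  zero_mem' a _ := by simp
  smul_mem' c x hx a ha := by
    rw [smul_comm]
    exact N.smul_mem c (hx a ha)

theorem mem_colonIdeal {N : Submodule R M} {I : Ideal R} {x : M} :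
    x ∈ colonIdeal N I ↔ ∀ a ∈ I, a • x ∈ N :=
  Iff.rfl

theorem colonIdeal_comm (N : Submodule R M) (I J : Ideal R) :
    colonIdeal (colonIdeal N I) J = colonIdeal (colonIdeal N J) I := by
  ext x
  simp only [mem_colonIdeal]
  constructor <;> intro h a ha b hb <;> rw [smul_comm] <;> exact h b hb a ha

theorem associatedPrimes_colonIdeal_subset [IsNoetherianRing R] (N : Submodule R M)
    (I : Ideal R) :
    associatedPrimes R (M ⧸ colonIdeal N I) ⊆ associatedPrimes R (M ⧸ N) := by
  intro q hq
  obtain ⟨hq, x, hx⟩ := mem_associatedPrimes_quotient_iff.mp hq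
  obtain ⟨s, hs⟩ := IsNoetherian.noetherian I
  have hsI : ∀ b ∈ s, b ∈ I := fun b hb => hs ▸ subset_span hb
  have hle : s.inf (fun b => N.colon {b • x}) ≤ q := by
    intro a ha
    rw [mem_finsetInf] at ha
    rw [hx, mem_colonIdeal]
    have hIle : I ≤ N.colon {a • x} := by
      rw [← hs, span_le]
      intro b hb
      have h := ha b hb
      rw [mem_colon_singleton] at h
      rwa [SetLike.mem_coe, mem_colon_singleton, smul_comm]
    exact fun b hb => mem_colon_singleton.mp (hIle hb)
  obtain ⟨b, hb, hbq⟩ := (Ideal.IsPrime.inf_le' hq).mp hle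
  refine mem_associatedPrimes_quotient_iff.mpr ⟨hq, b • x, fun a => ⟨fun ha => ?_, fun ha => ?_⟩⟩
  · rw [smul_comm]
    exact (hx a).mp ha b (hsI b hb)
  · exact hbq (mem_colon_singleton.mpr ha)

/-- `p` is a maximal element of `Ass(M/N)`. -/
def IsMaximalAssociatedPrime (p : Ideal R) (N : Submodule R M) : Prop :=
  p ∈ associatedPrimes R (M ⧸ N) ∧ ∀ q ∈ associatedPrimes R (M ⧸ N), p ≤ q → q = p

theorem IsMaximalAssociatedPrime.isPrimeExtension_colonIdeal [IsNoetherianRing R]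
    {N : Submodule R M} {p : Ideal R} (hp : IsMaximalAssociatedPrime p N) :
    IsPrimeExtension p N (colonIdeal N p) := by
  obtain ⟨hpr, x, hx⟩ := mem_associatedPrimes_quotient_iff.mp hp.1
  refine ⟨hpr, fun y hy a _ => N.smul_mem a hy, le_antisymm (fun c hc => ?_) (fun c hc => ?_), ?_⟩
  · exact (hx c).mpr (mem_colon.mp hc x fun a ha => (hx a).mp ha)
  · exact mem_colon.mpr fun y hy => hy c hc
  · intro a y hy hay
    by_contra! h
    obtain ⟨P, hP, hle⟩ := exists_le_isAssociatedPrime_of_isNoetherianRing R (N.mkQ y)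
      (by simpa using h.2)
    have hmem : ∀ b : R, b • y ∈ N → b ∈ P := fun b hb => hle <| by
      rw [mem_colon_singleton, mem_bot, ← map_smul, mkQ_apply, Quotient.mk_eq_zero]
      exact hb
    have hPp := hp.2 P hP fun b hb => hmem b (hy b hb)
    exact h.1 (hPp ▸ hmem a hay)

theorem IsPrimeExtension.le_colonIdeal {N K : Submodule R M} {p : Ideal R}
    (h : IsPrimeExtension p N K) : K ≤ colonIdeal N p := by
  intro x hx a ha
  rw [← h.2.2.1] at ha
  exact mem_colon.mp ha x hx

theorem isRegularPrimeExtension_iff [IsNoetherianRing R] {N K : Submodule R M} {p : Ideal R} :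
    IsRegularPrimeExtension p N K ↔ IsMaximalAssociatedPrime p N ∧ K = colonIdeal N p := by
  constructor
  · rintro ⟨⟨hK, hmax⟩, hp⟩
    have hp : IsMaximalAssociatedPrime p N := hp
    exact ⟨hp, hK.le_colonIdeal.eq_of_not_lt (hmax _ hp.isPrimeExtension_colonIdeal)⟩
  · rintro ⟨hp, rfl⟩
    exact ⟨⟨hp.isPrimeExtension_colonIdeal, fun L hL => hL.le_colonIdeal.not_gt⟩, hp⟩

theorem mem_associatedPrimes_quotient_colonIdeal [IsNoetherianRing R] {N : Submodule R M}
    {I q : Ideal R} (hq : q ∈ associatedPrimes R (M ⧸ N)) (hI : ¬ I ≤ q) :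
    q ∈ associatedPrimes R (M ⧸ colonIdeal N I) := by
  obtain ⟨hpr, x, hx⟩ := mem_associatedPrimes_quotient_iff.mp hq
  obtain ⟨b, hb, hbq⟩ := Set.not_subset.mp hI
  refine mem_associatedPrimes_quotient_iff.mpr ⟨hpr, x, fun a => ⟨fun ha c _ => ?_, fun ha => ?_⟩⟩
  · exact N.smul_mem c ((hx a).mp ha)
  · have hba := ha b hb
    rw [smul_smul, ← hx] at hba
    exact (hpr.mem_or_mem hba).resolve_left hbq

/-- Primes of consecutive regular extensions can be exchanged unless the second one is strictly
contained in the first one. -/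
theorem IsMaximalAssociatedPrime.swap [IsNoetherianRing R] {N : Submodule R M} {p q : Ideal R}
    (hp : IsMaximalAssociatedPrime p N) (hq : IsMaximalAssociatedPrime q (colonIdeal N p))
    (hqp : ¬ q < p) :
    IsMaximalAssociatedPrime q N ∧ IsMaximalAssociatedPrime p (colonIdeal N q) := by
  rcases eq_or_ne p q with rfl | hne
  · exact ⟨hp, hq⟩
  have hqN := associatedPrimes_colonIdeal_subset N p hq.1
  have hqp' : ¬ q ≤ p := fun h => hqp (h.lt_of_ne hne.symm)
  refine ⟨⟨hqN, fun r hr hle => ?_⟩, ⟨mem_associatedPrimes_quotient_colonIdeal hp.1 hqp', ?_⟩⟩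
  · refine hq.2 r (mem_associatedPrimes_quotient_colonIdeal hr fun h => ?_) hle
    exact hqp' (hp.2 r hr h ▸ hle)
  · exact fun r hr => hp.2 r (associatedPrimes_colonIdeal_subset N q hr)

/-- `N` admits an RPE filtration whose successive primes are the entries of the list. -/
def HasRPEList : Submodule R M → List (Ideal R) → Prop
  | N, [] => N = ⊤
  | N, p :: l => IsMaximalAssociatedPrime p N ∧ HasRPEList (colonIdeal N p) l

theorem hasRPEList_ofFn_iff [IsNoetherianRing R] (n : ℕ) (N : Submodule R M)
    (p : Fin n → Ideal R) :
    HasRPEList N (List.ofFn p) ↔ ∃ F, IsRPEFiltration N n F p := by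
  induction n generalizing N with
  | zero =>
    rw [List.ofFn_zero]
    constructor
    · intro h
      exact ⟨fun _ => N, rfl, h, fun i => i.elim0⟩
    · rintro ⟨F, h0, hn, _⟩
      exact h0.symm.trans hn
  | succ n ih =>
    rw [List.ofFn_succ, HasRPEList, ih]
    constructor
    · rintro ⟨hp, F, h0, hn, hF⟩
      refine ⟨Fin.cons N F, rfl, ?_, fun i => ?_⟩
      · rw [← Fin.succ_last, Fin.cons_succ, hn]
      · refine Fin.cases ?_ (fun j => ?_) i
        · rw [Fin.castSucc_zero, Fin.cons_zero, Fin.cons_succ, isRegularPrimeExtension_iff]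
          exact ⟨hp, h0⟩
        · rw [← Fin.succ_castSucc, Fin.cons_succ, Fin.cons_succ]
          exact hF j
    · rintro ⟨F, h0, hn, hF⟩
      have h1 := hF 0
      rw [Fin.castSucc_zero, h0, isRegularPrimeExtension_iff] at h1
      refine ⟨h1.1, fun i => F i.succ, h1.2, hn, fun i => ?_⟩
      simpa only [Fin.succ_castSucc] using hF i.succ

theorem HasRPEList.move_to_front [IsNoetherianRing R] {N : Submodule R M}
    {l₁ l₂ : List (Ideal R)} {q : Ideal R} (h : HasRPEList N (l₁ ++ q :: l₂))
    (hq : ∀ a ∈ l₁, ¬ q < a) : HasRPEList N (q :: (l₁ ++ l₂)) := by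
  induction l₁ generalizing N with
  | nil => exact h
  | cons a l₁ ih =>
    obtain ⟨hqa, hl⟩ := ih h.2 fun b hb => hq b (List.mem_cons_of_mem a hb)
    obtain ⟨hqN, haN⟩ := h.1.swap hqa (hq a List.mem_cons_self)
    exact ⟨hqN, haN, colonIdeal_comm N a q ▸ hl⟩

theorem HasRPEList.perm [IsNoetherianRing R] {N : Submodule R M} {l l' : List (Ideal R)}
    (h : HasRPEList N l) (hperm : l'.Perm l) (hl' : l'.Pairwise fun a b => ¬ a < b) :
    HasRPEList N l' := by
  induction l' generalizing N l with
  | nil => exact List.nil_perm.mp hperm ▸ h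
  | cons q t ih =>
    obtain ⟨hqt, ht⟩ := List.pairwise_cons.mp hl'
    obtain ⟨l₁, l₂, rfl⟩ := List.append_of_mem (hperm.subset List.mem_cons_self)
    have htl : t.Perm (l₁ ++ l₂) := (hperm.trans List.perm_middle).cons_inv
    obtain ⟨hq, hl⟩ := h.move_to_front fun a ha =>
      hqt a (htl.symm.subset (List.mem_append_left l₂ ha))
    exact ⟨hq, ih hl htl ht⟩

end Helpers

/-- If `N = M_0 ⊂ ⋯ ⊂ M_n = M` is an RPE filtration over a proper submodule `N` with
primes `p_1, …, p_n`, and `p_1', …, p_n'` is a reordering of the primes (given by a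
permutation `σ`) with `p_i' ⊄ p_j'` whenever `i < j`, then there is an RPE filtration
of `M` over `N` whose `i`-th prime is `p_i'`. -/
theorem stmt_18 {R : Type*} [CommRing R] [IsNoetherianRing R]
    {M : Type*} [AddCommGroup M] [Module R M] [Module.Finite R M]
    (N : Submodule R M) (hN : N ≠ ⊤) (n : ℕ)
    (F : Fin (n + 1) → Submodule R M) (p : Fin n → Ideal R)
    (hF : IsRPEFiltration N n F p) (σ : Equiv.Perm (Fin n))
    (hord : ∀ i j : Fin n, i < j → ¬ (p (σ i) < p (σ j))) :
    ∃ F' : Fin (n + 1) → Submodule R M, IsRPEFiltration N n F' (fun i => p (σ i)) := by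
  rw [← hasRPEList_ofFn_iff]
  exact ((hasRPEList_ofFn_iff n N p).mpr ⟨F, hF⟩).perm (σ.ofFn_comp_perm p)
    (List.pairwise_ofFn.mpr fun i j hij => hord i j hij)
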